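/- Let (R,𝔪) be a universally catenary Noetherian local ring and M a finitely generated equidimensional R-module. Then the 𝔪-adic completion M̂ is an equidimensional R̂-module. -/

import Mathlib

noncomputable section
open CategoryTheory

namespace Paper

variable (R : Type) [CommRing R]

/-- The `i`-th local cohomology of the `R`-module `M` with respect to the ideal `I`. -/
abbrev H (I : Ideal R) (i : ℕ) (M : Type) [AddCommGroup M] [Module R M] : ModuleCat R :=
  (localCohomology I i).obj (ModuleCat.of R M)

/-- `N` is a `p`-secondary submodule of `M`: it is nonzero, every `r : R` acts on it either
surjectively or nilpotently, and `p` is the radical of its annihilator. -/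
def IsSecondaryFor {M : Type} [AddCommGroup M] [Module R M]
    (N : Submodule R M) (p : Ideal R) : Prop :=
  N ≠ ⊥ ∧
  (∀ r : R, (∀ m ∈ N, ∃ n ∈ N, r • n = m) ∨ (∃ k : ℕ, ∀ m ∈ N, r ^ k • m = 0)) ∧
  N.annihilator.radical = p

/-- A minimal secondary representation of the module `M`. -/
structure MinSecRep (M : Type) [AddCommGroup M] [Module R M] where
  n : ℕ
  S : Fin n → Submodule R M
  p : Fin n → Ideal R
  prime : ∀ i, (p i).IsPrime
  sec : ∀ i, IsSecondaryFor R (S i) (p i)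
  sum : (⨆ i, S i) = ⊤
  inj : Function.Injective p
  irred : ∀ j, ¬ (S j ≤ ⨆ i ∈ ({j}ᶜ : Set (Fin n)), S i)

/-- `M` is representable: it is a (finite) sum of secondary submodules. -/
def IsRepresentable (M : Type) [AddCommGroup M] [Module R M] : Prop :=
  ∃ (n : ℕ) (S : Fin n → Submodule R M) (p : Fin n → Ideal R),
    (∀ i, (p i).IsPrime) ∧ (∀ i, IsSecondaryFor R (S i) (p i)) ∧ (⨆ i, S i) = ⊤

/-- The set of attached primes of `M`: the primes occurring in a minimal secondary
representation of `M`. -/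
def attached (M : Type) [AddCommGroup M] [Module R M] : Set (Ideal R) :=
  {q | ∃ (rep : MinSecRep R M) (i : Fin rep.n), rep.p i = q}

/-- The coheight (dimension of `R/I`): Krull dimension of the set of primes containing `I`. -/
def coheight (I : Ideal R) : WithBot ℕ∞ :=
  Order.krullDim {p : Ideal R // p.IsPrime ∧ I ≤ p}

/-- The Krull dimension of the ring `R`. -/
def ringDim : WithBot ℕ∞ := Order.krullDim {p : Ideal R // p.IsPrime}

/-- The Krull dimension of (the support of) the finitely generated module `M`. -/
def dimMod (M : Type) [AddCommGroup M] [Module R M] : WithBot ℕ∞ :=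
  coheight R (Module.annihilator R M)

/-- The dimension of the localized module `M_q`: chains of primes in the support of `M`
contained in `q`. -/
def dimModAt (M : Type) [AddCommGroup M] [Module R M] (q : Ideal R) : WithBot ℕ∞ :=
  Order.krullDim {p : Ideal R // p.IsPrime ∧ Module.annihilator R M ≤ p ∧ p ≤ q}

/-- The support of a finitely generated module: primes containing the annihilator. -/
def supp (M : Type) [AddCommGroup M] [Module R M] : Set (Ideal R) :=
  {p | p.IsPrime ∧ Module.annihilator R M ≤ p}

/-- `Min M`: minimal primes of the support of `M`. -/
def minSupp (M : Type) [AddCommGroup M] [Module R M] : Set (Ideal R) :=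
  (Module.annihilator R M).minimalPrimes

/-- `Assh M`: primes in the support of maximal coheight. -/
def assh (M : Type) [AddCommGroup M] [Module R M] : Set (Ideal R) :=
  {p | p ∈ supp R M ∧ coheight R p = dimMod R M}

open RingTheory.Sequence in
/-- Depth of `M` with respect to the ideal `J`: supremum of the lengths of `M`-regular
sequences contained in `J`. -/
def depthOn (J : Ideal R) (M : Type) [AddCommGroup M] [Module R M] : ℕ∞ :=
  ⨆ l ∈ {l : List R | (∀ x ∈ l, x ∈ J) ∧ IsRegular M l}, (l.length : ℕ∞)

/-- `M` is a Cohen–Macaulay module over the local ring `R`: depth = dimension. -/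
def IsCMLocalMod [IsLocalRing R] (M : Type) [AddCommGroup M] [Module R M] : Prop :=
  (depthOn R (IsLocalRing.maximalIdeal R) M : WithBot ℕ∞) = dimMod R M

/-- `R` is a Cohen–Macaulay local ring: it is local and its depth (w.r.t. its Jacobson
radical, which is the maximal ideal) equals its Krull dimension. -/
def IsCMLocalRing : Prop :=
  IsLocalRing R ∧ ((depthOn R ((⊥ : Ideal R).jacobson) R : WithBot ℕ∞) = ringDim R)

/-- `R` is a Cohen–Macaulay ring: all of its localizations at primes are CM local rings. -/
def IsCMRing : Prop :=
  ∀ (p : Ideal R) [p.IsPrime], IsCMLocalRing (Localization.AtPrime p)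

/-- `M` is an equidimensional module: every minimal prime of its support has coheight equal
to the dimension of `M`. -/
def IsEquidim (M : Type) [AddCommGroup M] [Module R M] : Prop :=
  ∀ q ∈ minSupp R M, coheight R q = dimMod R M

/-- `R` is catenary: any two saturated chains of primes with the same endpoints have the
same length. -/
def IsCatenary : Prop :=
  ∀ (c₁ c₂ : LTSeries {p : Ideal R // p.IsPrime}),
    c₁.head = c₂.head → c₁.last = c₂.last →
    (∀ i : Fin c₁.length, c₁.toFun i.castSucc ⋖ c₁.toFun i.succ) →
    (∀ i : Fin c₂.length, c₂.toFun i.castSucc ⋖ c₂.toFun i.succ) →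
    c₁.length = c₂.length

/-- `R` is universally catenary: every finitely generated `R`-algebra is catenary. -/
def IsUnivCatenary : Prop :=
  ∀ (A : Type) [CommRing A] [Algebra R A], Algebra.FiniteType R A → IsCatenary A

/-- `x` is a uniform local cohomological annihilator of `M`: `x` avoids all minimal primes
of `M` and, for every maximal ideal `m`, kills `H^i_m(M)` for all `i < dim M_m`. -/
def IsULCA (M : Type) [AddCommGroup M] [Module R M] (x : R) : Prop :=
  (∀ p ∈ minSupp R M, x ∉ p) ∧
  ∀ (m : Ideal R), m.IsMaximal → ∀ i : ℕ, (i : WithBot ℕ∞) < dimModAt R M m →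
    ∀ y : H R m i M, x • y = 0

/-- `M` has a uniform local cohomological annihilator. -/
def HasULCA (M : Type) [AddCommGroup M] [Module R M] : Prop := ∃ x, IsULCA R M x

/-- `R/p` has a uniform local cohomological annihilator (local case): some `x ∉ p` kills
`H^i_𝔪(R/p)` for all `i < dim R/p`. -/
def HasULCAQuot [IsLocalRing R] (p : Ideal R) : Prop :=
  ∃ x ∉ p, ∀ i : ℕ, (i : WithBot ℕ∞) < coheight R p →
    ∀ y : H R (IsLocalRing.maximalIdeal R) i (R ⧸ p), x • y = 0

/-- `M` is generalized Cohen–Macaulay over the local ring `R`: a power of the maximal ideal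
kills all local cohomology below the dimension. -/
def IsGCM [IsLocalRing R] (M : Type) [AddCommGroup M] [Module R M] : Prop :=
  ∃ n : ℕ, ∀ i : ℕ, (i : WithBot ℕ∞) < dimMod R M →
    ∀ a ∈ (IsLocalRing.maximalIdeal R) ^ n,
      ∀ y : H R (IsLocalRing.maximalIdeal R) i M, a • y = 0

end Paper

theorem AdicCompletion.ker_evalₐ_eq_map_pow {R : Type*} [CommRing R] {I : Ideal R} (fg : I.FG)
    (n : ℕ) : RingHom.ker (AdicCompletion.evalₐ I n) =
      (I.map (algebraMap R (AdicCompletion I R))) ^ n := by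
  have h := AdicCompletion.pow_smul_top_eq_ker_eval (I := I) (M := R) (n := n) fg
  ext x
  have h1 : x ∈ (AdicCompletion.eval I R n).ker ↔
      x ∈ (I.map (algebraMap R (AdicCompletion I R))) ^ n := by
    rw [← h, ← Ideal.map_pow, Ideal.smul_top_eq_map, Submodule.restrictScalars_mem]
  rw [← h1, RingHom.mem_ker, LinearMap.mem_ker,
    ← AdicCompletion.factor_eval_eq_evalₐ I x (le_of_eq (Ideal.mul_top _))]
  refine map_eq_zero_iff _ ?_
  have eq : I ^ n * ⊤ = I ^ n := by simp
  have : Function.Injective (Ideal.Quotient.factor (le_of_eq eq)) := by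
    simpa [RingHom.injective_iff_ker_eq_bot, Ideal.Quotient.factor_ker]
      using Ideal.map_mk_eq_bot_of_le (le_of_eq eq.symm)
  exact this

theorem AdicCompletion.exists_sub_algebraMap_mem {R : Type*} [CommRing R] {I : Ideal R} (fg : I.FG)
    (n : ℕ) (x : AdicCompletion I R) : ∃ r : R, x - algebraMap R (AdicCompletion I R) r ∈
      (I.map (algebraMap R (AdicCompletion I R))) ^ n := by
  obtain ⟨r, hr⟩ := Ideal.Quotient.mk_surjective (AdicCompletion.evalₐ I n x)
  refine ⟨r, ?_⟩
  rw [← AdicCompletion.ker_evalₐ_eq_map_pow fg, RingHom.mem_ker, map_sub, sub_eq_zero,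
    AlgHom.commutes, ← hr]
  rfl

theorem AdicCompletion.comap_map_pow_le {R : Type*} [CommRing R] {I : Ideal R} (fg : I.FG)
    (n : ℕ) : ((I.map (algebraMap R (AdicCompletion I R))) ^ n).comap
      (algebraMap R (AdicCompletion I R)) ≤ I ^ n := by
  intro r hr
  rw [Ideal.mem_comap, ← AdicCompletion.ker_evalₐ_eq_map_pow fg, RingHom.mem_ker,
    AlgHom.commutes] at hr
  exact Ideal.Quotient.eq_zero_iff_mem.mp hr

theorem AdicCompletion.isNoetherianRing {R : Type*} [CommRing R] [IsNoetherianRing R]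
    (I : Ideal R) : IsNoetherianRing (AdicCompletion I R) := by
  have fg : I.FG := I.fg_of_isNoetherianRing
  obtain ⟨n, s, hs⟩ := Submodule.fg_iff_exists_fin_generating_family.mp fg
  let P := MvPolynomial (Fin n) R
  let J : Ideal P := MvPolynomial.idealOfVars (Fin n) R
  have hJ : J.FG := MvPolynomial.idealOfVars_fg (Fin n) R
  let π : P →+* R := (MvPolynomial.aeval s : P →ₐ[R] R).toRingHom
  have hX : ∀ i, π (MvPolynomial.X i) = s i := fun i ↦ MvPolynomial.aeval_X s i
  have hC : ∀ r, π (MvPolynomial.C r) = r := fun r ↦ MvPolynomial.aeval_C s r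
  have hπ : J.map π = I := by
    have : J = Ideal.span (Set.range MvPolynomial.X) := rfl
    rw [this, Ideal.map_span, ← Set.range_comp, ← hs]
    congr 1
    ext; simp [hX]
  let g : (k : ℕ) → AdicCompletion J P →+* R ⧸ I ^ k := fun k ↦
    (Ideal.quotientMap (I ^ k) π (by
      rw [← Ideal.map_le_iff_le_comap, Ideal.map_pow, hπ])).comp (AdicCompletion.evalₐ J k : _ →+* _)
  have hg : ∀ {m n : ℕ} (hle : m ≤ n), (Ideal.Quotient.factorPow I hle).comp (g n) = g m := by
    intro a b hab
    ext x
    obtain ⟨r, hr⟩ := AdicCompletion.exists_sub_algebraMap_mem hJ b x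
    have ha := Ideal.pow_le_pow_right hab hr
    rw [← AdicCompletion.ker_evalₐ_eq_map_pow hJ, RingHom.mem_ker, map_sub, sub_eq_zero,
      AlgHom.commutes] at hr ha
    simp only [g, RingHom.comp_apply, RingHom.coe_coe]
    rw [hr, ha]
    rfl
  let F := AdicCompletion.liftRingHom I g hg
  have hFof : ∀ p : P, F (algebraMap P _ p) = algebraMap R _ (π p) := by
    intro p
    refine AdicCompletion.ext_evalₐ (I := I) fun k ↦ ?_
    rw [AdicCompletion.evalₐ_liftRingHom, AlgHom.commutes]
    simp only [g, RingHom.comp_apply, RingHom.coe_coe]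
    rw [AlgHom.commutes]
    rfl
  have : IsNoetherianRing (AdicCompletion J P) :=
    isNoetherianRing_of_ringEquiv _ (MvPowerSeries.toAdicCompletionAlgEquiv (Fin n) R).toRingEquiv
  have hmap : (J.map (algebraMap P (AdicCompletion J P))).map F =
      I.map (algebraMap R (AdicCompletion I R)) := by
    have h : F.comp (algebraMap P (AdicCompletion J P)) =
        (algebraMap R (AdicCompletion I R)).comp π := RingHom.ext hFof
    rw [Ideal.map_map, h, ← Ideal.map_map, hπ]
  have hc := AdicCompletion.isAdicComplete_self J hJ
  have hc' := AdicCompletion.isAdicComplete_self I fg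
  rw [← hmap] at hc'
  have := hc.toIsPrecomplete
  have := hc'.toIsHausdorff
  refine isNoetherianRing_of_surjective _ _ F
    (surjective_of_mk_map_comp_surjective (I := J.map (algebraMap P (AdicCompletion J P))) F ?_)
  intro y
  obtain ⟨y, rfl⟩ := Ideal.Quotient.mk_surjective y
  obtain ⟨r, hr⟩ := AdicCompletion.exists_sub_algebraMap_mem fg 1 y
  refine ⟨algebraMap P _ (MvPolynomial.C r), ?_⟩
  rw [RingHom.comp_apply, hFof, Ideal.Quotient.eq, hC, hmap, ← neg_mem_iff]
  simpa using hr

theorem Polynomial.eq_bot_of_isPrime_lt_of_comap_C_eq_bot {C : Type*} [CommRing C] [IsDomain C]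
    {P' P : Ideal (Polynomial C)} [P'.IsPrime] [P.IsPrime] (hP : P.comap Polynomial.C = ⊥)
    (h : P' < P) : P' = ⊥ := by
  by_contra hne
  let K := FractionRing C
  let _ := (Polynomial.mapRingHom (algebraMap C K)).toAlgebra
  have : IsLocalization ((nonZeroDivisors C).map (Polynomial.C : C →+* Polynomial C))
    (Polynomial K) := Polynomial.isLocalization (nonZeroDivisors C) K
  have hdisj : ∀ J : Ideal (Polynomial C), J.comap Polynomial.C = ⊥ →
      Disjoint ((nonZeroDivisors C).map (Polynomial.C : C →+* Polynomial C) : Set (Polynomial C))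
        (J : Set (Polynomial C)) := by
    intro J hJ
    rw [Set.disjoint_left]
    rintro _ ⟨c, hc, rfl⟩ hcJ
    have : c ∈ J.comap Polynomial.C := hcJ
    rw [hJ, Ideal.mem_bot] at this
    exact nonZeroDivisors.ne_zero hc this
  have hP' : P'.comap Polynomial.C = ⊥ := le_bot_iff.mp (hP ▸ Ideal.comap_mono h.le)
  set f := algebraMap (Polynomial C) (Polynomial K)
  set M := (nonZeroDivisors C).map (Polynomial.C : C →+* Polynomial C)
  have h1 := IsLocalization.isPrime_of_isPrime_disjoint M (Polynomial K) P' ‹_› (hdisj _ hP')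
  have h2 := IsLocalization.isPrime_of_isPrime_disjoint M (Polynomial K) P ‹_› (hdisj _ hP)
  have c1 := IsLocalization.under_map_of_isPrime_disjoint M (Polynomial K) ‹P'.IsPrime› (hdisj _ hP')
  have c2 := IsLocalization.under_map_of_isPrime_disjoint M (Polynomial K) ‹P.IsPrime› (hdisj _ hP)
  have h3 : P'.map f ≠ ⊥ := by
    intro h0
    apply hne
    rw [eq_bot_iff, ← c1, h0]
    intro x hx
    have hx : f x = 0 := hx
    exact Polynomial.map_injective _ (IsFractionRing.injective C K)
      (hx.trans (Polynomial.map_zero _).symm)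
  have h4 := (h1.isMaximal h3).eq_of_le h2.ne_top (Ideal.map_mono h.le)
  exact h.ne (by rw [← c1, ← c2, h4])

theorem Ideal.wellFoundedLT_subtype_isPrime (A : Type*) [CommRing A] [IsNoetherianRing A] :
    WellFoundedLT {p : Ideal A // p.IsPrime} := by
  have : StrictMono (fun p : {p : Ideal A // p.IsPrime} ↦ p.1.height) := by
    intro p q hpq
    have := p.2
    have := q.2
    exact Ideal.height_strict_mono_of_isPrime_of_isPrime hpq
  exact this.wellFoundedLT

/-- The height of a prime does not drop along a map `C → C'` with `C'` a nontrivial quotient of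
`C[X]`, if the prime contains the image of `X` and `C[X]` is catenary. -/
theorem Paper.IsCatenary.height_comap_le {C C' : Type} [CommRing C] [IsDomain C]
    [IsNoetherianRing C] [CommRing C'] [IsDomain C'] (hcat : Paper.IsCatenary (Polynomial C))
    (π : Polynomial C →+* C') (hπ : Function.Surjective π)
    (hinj : Function.Injective (π.comp Polynomial.C)) (hker : RingHom.ker π ≠ ⊥)
    (N : Ideal C') [N.IsPrime] (hX : π Polynomial.X ∈ N) :
    (N.comap (π.comp Polynomial.C)).height ≤ N.height := by
  set α := {p : Ideal (Polynomial C) // p.IsPrime}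
  have : WellFoundedLT α := Ideal.wellFoundedLT_subtype_isPrime _
  have : WellFoundedGT α := (Subtype.strictMono_coe _).wellFoundedGT
  let P : α := ⟨RingHom.ker π, RingHom.ker_isPrime π⟩
  let Q : α := ⟨N.comap π, inferInstance⟩
  let B : α := ⟨⊥, Ideal.isPrime_bot⟩
  have hPQ : P ≤ Q := fun x hx ↦ by
    have hx : π x = 0 := hx
    change π x ∈ N
    simp [hx]
  have hPC : P.1.comap Polynomial.C = ⊥ := by
    rw [eq_bot_iff]
    intro c hc
    exact hinj ((show π (Polynomial.C c) = 0 from hc).trans (map_zero (π.comp Polynomial.C)).symm)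
  have hBP : B ⋖ P := by
    refine ⟨bot_lt_iff_ne_bot.mpr hker, fun p hp hpP ↦ ?_⟩
    have := p.2
    have := P.2
    exact hp.ne' (Subtype.ext (Polynomial.eq_bot_of_isPrime_lt_of_comap_C_eq_bot hPC hpP))
  obtain ⟨t, ht0, m, htm, htcov⟩ := exists_covBy_seq_of_wellFoundedLT_wellFoundedGT_of_le hPQ
  let t₂ : RelSeries {(a, b) : α × α | a ⋖ b} := ⟨m, (t ·), fun i ↦ by simpa using htcov i i.2⟩
  have hm : (m : ℕ∞) ≤ N.height := by
    have hmono : Monotone t₂.toFun :=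
      Fin.monotone_iff_le_succ.mpr fun i ↦ (t₂.step i).le
    have hle (i : Fin (m + 1)) : RingHom.ker π ≤ (t i).1 := by
      have : t₂.toFun 0 ≤ t₂.toFun i := hmono (Fin.zero_le i)
      have h0 : t₂.toFun 0 = P := ht0
      rw [h0] at this
      exact this
    let T : LTSeries (PrimeSpectrum C') := ⟨m, fun i ↦ ⟨(t i).1.map π,
      have := (t i).2
      Ideal.map_isPrime_of_surjective hπ (hle i)⟩, fun i ↦ by
        have h := (t₂.step i).lt
        refine lt_of_le_of_ne (Ideal.map_mono h.le) fun heq ↦ h.ne ?_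
        have heq := congrArg (Ideal.comap π) heq
        simp only [Ideal.comap_map_of_surjective' π hπ] at heq
        rw [sup_eq_left.mpr (hle _), sup_eq_left.mpr (hle _)] at heq
        exact Subtype.ext heq⟩
    have hlast : T.last = ⟨N, inferInstance⟩ := by
      refine PrimeSpectrum.ext ?_
      change (t m).1.map π = N
      rw [htm]
      exact Ideal.map_comap_of_surjective π hπ N
    have := Order.length_le_height_last (p := T)
    rwa [hlast, ← PrimeSpectrum.height_eq_orderHeight] at this
  refine le_trans ?_ hm
  set p := N.comap (π.comp Polynomial.C)
  obtain ⟨l, hl, hlen⟩ := Ideal.exists_ltSeries_length_eq_height p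
  rw [← hlen, Nat.cast_le]
  let φ : PrimeSpectrum C → α := fun q ↦ ⟨q.asIdeal.comap (Polynomial.evalRingHom 0), inferInstance⟩
  have hev : Function.Surjective (Polynomial.evalRingHom (0 : C)) := fun c ↦
    ⟨Polynomial.C c, by simp⟩
  have hφ : StrictMono φ := by
    intro q q' h
    refine lt_of_le_of_ne (Ideal.comap_mono h.le) fun heq ↦ h.ne ?_
    exact PrimeSpectrum.ext (Ideal.comap_injective_of_surjective _ hev (congrArg Subtype.val heq))
  have hφp : φ ⟨p, inferInstance⟩ = Q := by
    refine Subtype.ext ?_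
    ext f
    change π (Polynomial.C (Polynomial.eval 0 f)) ∈ N ↔ π f ∈ N
    have : f = Polynomial.X * f.divX + Polynomial.C (Polynomial.eval 0 f) := by
      conv_lhs => rw [← Polynomial.X_mul_divX_add f]
      rw [Polynomial.coeff_zero_eq_eval_zero]
    conv_rhs => rw [this, map_add, map_mul]
    exact (N.add_mem_iff_right (N.mul_mem_right _ hX)).symm
  let s₁ : LTSeries α := (l.map φ hφ).cons B (by
    change B < _
    refine lt_of_le_of_ne (bot_le (a := (l.map φ hφ).head.1)) fun heq ↦ ?_
    have h : (Polynomial.X : Polynomial C) ∈ (l.map φ hφ).head.1 := by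
      change Polynomial.eval 0 Polynomial.X ∈ l.head.asIdeal
      simp
    rw [← heq] at h
    exact Polynomial.X_ne_zero h)
  obtain ⟨u, i, hi, hi0, hil⟩ := s₁.exists_relSeries_covBy
  let t₁ : RelSeries {(a, b) : α × α | a ⋖ b} := t₂.cons B (by
    have h0 : t₂.head = P := ht0
    rw [h0]
    exact hBP)
  have hcard := Fintype.card_le_of_embedding i
  simp only [Fintype.card_fin] at hcard
  have hlen₁ : s₁.length = l.length + 1 := RelSeries.cons_length ..
  have hlen₂ : t₁.length = m + 1 := RelSeries.cons_length ..
  have := hcat ⟨u.length, u.toFun, fun i ↦ (u.step i).lt⟩ ⟨t₁.length, t₁.toFun, fun i ↦ (t₁.step i).lt⟩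
    (by
      change u.toFun 0 = t₁.head
      rw [← hi0]
      exact congrFun hi 0)
    (by
      change u.toFun (Fin.last _) = t₁.last
      rw [← hil]
      refine (congrFun hi _).trans ?_
      rw [RelSeries.last_cons]
      change s₁.last = t m
      rw [htm, RelSeries.last_cons, LTSeries.last_map, hl]
      exact hφp)
    u.step t₁.step
  change u.length = t₁.length at this
  omega

/-- Over a universally catenary domain `A`, a prime of a finitely generated birational extension of
`A` that contains the generators has at least the height of its contraction to `A`. -/
theorem Paper.IsUnivCatenary.height_comap_le_of_eq_adjoin {A K : Type} [CommRing A] [IsDomain A]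
    [IsNoetherianRing A] (huc : Paper.IsUnivCatenary A) [Field K] [Algebra A K]
    [IsFractionRing A K] (s : Finset K) (B : Subalgebra A K)
    (hB : B = Algebra.adjoin A (s : Set K)) (N : Ideal B) [N.IsPrime]
    (hN : ∀ y : B, (y : K) ∈ s → y ∈ N) :
    (N.comap (algebraMap A B)).height ≤ N.height := by
  classical
  induction s using Finset.induction_on generalizing B with
  | empty =>
    have hb : Function.Bijective (algebraMap A B) := by
      refine ⟨FaithfulSMul.algebraMap_injective A B, fun x ↦ ?_⟩
      have hx : (x : K) ∈ Algebra.adjoin A ((∅ : Finset K) : Set K) := hB ▸ x.2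
      rw [Finset.coe_empty, Algebra.adjoin_empty, Algebra.mem_bot] at hx
      obtain ⟨a, ha⟩ := hx
      exact ⟨a, Subtype.ext ha⟩
    exact (RingEquiv.height_comap (RingEquiv.ofBijective _ hb) N).le
  | insert u s hu ih =>
    let C := Algebra.adjoin A (s : Set K)
    have : Algebra.FiniteType A C :=
      (Subalgebra.fg_iff_finiteType _).mp (Subalgebra.fg_adjoin_finset s)
    have : IsNoetherianRing C := Algebra.FiniteType.isNoetherianRing A C
    have hft : Algebra.FiniteType A (Polynomial C) :=
      Algebra.FiniteType.trans (S := C) inferInstance inferInstance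
    have hCB : C ≤ B := by
      rw [hB, Finset.coe_insert]
      exact Algebra.adjoin_mono (Set.subset_insert _ _)
    have huB : u ∈ B := by
      rw [hB]
      exact Algebra.subset_adjoin (by simp)
    let π : Polynomial C →+* B :=
      Polynomial.eval₂RingHom (Subalgebra.inclusion hCB).toRingHom ⟨u, huB⟩
    have hπ_val (f : Polynomial C) : (π f : K) = Polynomial.aeval u f := by
      have : (B.val.toRingHom).comp π = (Polynomial.aeval (R := C) u).toRingHom := by
        ext x
        · simp [π]
        · simp [π]
      exact congrArg (fun g : Polynomial C →+* K ↦ g f) this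
    have hπ : Function.Surjective π := by
      intro x
      have hx : (x : K) ∈ ((Polynomial.aeval (R := C) u).restrictScalars A).range := by
        have hle : Algebra.adjoin A (↑(insert u s) : Set K) ≤
            ((Polynomial.aeval (R := C) u).restrictScalars A).range := by
          refine Algebra.adjoin_le fun y hy ↦ ?_
          rw [Finset.coe_insert, Set.mem_insert_iff] at hy
          rcases hy with rfl | hy
          · exact ⟨Polynomial.X, by simp⟩
          · exact ⟨Polynomial.C ⟨y, Algebra.subset_adjoin hy⟩, by simp⟩
        exact hle (hB ▸ x.2)
      obtain ⟨f, hf⟩ := hx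
      exact ⟨f, Subtype.ext ((hπ_val f).trans hf)⟩
    have hπC (c : C) : π (Polynomial.C c) = Subalgebra.inclusion hCB c :=
      Polynomial.eval₂_C _ _
    have hinj : Function.Injective (π.comp Polynomial.C) := fun x y h ↦
      Subalgebra.inclusion_injective hCB ((hπC x).symm.trans (h.trans (hπC y)))
    have hker : RingHom.ker π ≠ ⊥ := by
      obtain ⟨b, c, hc, hbc⟩ := IsFractionRing.div_surjective (A := A) u
      intro h0
      have hmem : Polynomial.C (algebraMap A C c) * Polynomial.X - Polynomial.C (algebraMap A C b) ∈
          RingHom.ker π := by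
        rw [RingHom.mem_ker]
        refine Subtype.ext ?_
        rw [hπ_val]
        have hc' : algebraMap A K c ≠ 0 := by simpa using nonZeroDivisors.ne_zero hc
        simp only [map_sub, map_mul, Polynomial.aeval_C, Polynomial.aeval_X,
          ← IsScalarTower.algebraMap_apply, ← hbc]
        rw [mul_div_cancel₀ _ hc', sub_self]
        rfl
      rw [h0, Ideal.mem_bot] at hmem
      have := congrArg (fun f ↦ Polynomial.coeff f 1) hmem
      simp [Polynomial.coeff_C] at this
      exact nonZeroDivisors.ne_zero hc this
    have key := Paper.IsCatenary.height_comap_le (huc _ hft) π hπ hinj hker N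
      (hN _ (by simp [π]))
    refine le_trans ?_ key
    refine le_trans (le_of_eq ?_) (ih C rfl (N.comap (π.comp Polynomial.C)) ?_)
    · rw [Ideal.comap_comap]
      congr 2
      ext a
      change algebraMap A K a = (π (Polynomial.C (algebraMap A C a)) : K)
      rw [hπC]
      rfl
    · intro y hy
      change π (Polynomial.C y) ∈ N
      refine hN _ ?_
      rw [hπC]
      exact Finset.mem_insert_of_mem hy

/-- A dimension bound in a universally catenary local domain, obtained by blowing up an ideal
`(f, Y, Z)` primary to the maximal ideal: if the elements of `Z` are nilpotent in degree one of the
fiber cone up to multiplication by `f`, and `f` is not nilpotent in the fiber cone modulo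
`(Y, Z)`, then the dimension is at most `#Y + 1`. -/
theorem Paper.IsUnivCatenary.ringKrullDim_le_card_add_one {A : Type} [CommRing A] [IsDomain A]
    [IsNoetherianRing A] [IsLocalRing A] (huc : Paper.IsUnivCatenary A) (f : A) (Y Z : Finset A)
    (I T : Ideal A) (hT : T = Ideal.span Y ⊔ Ideal.span Z) (hI : I = Ideal.span {f} ⊔ T)
    (hfm : f ∈ IsLocalRing.maximalIdeal A) (hmI : IsLocalRing.maximalIdeal A ≤ I.radical)
    (hZ : ∀ z ∈ Z, ∃ s, f ^ s * z ^ s ∈ IsLocalRing.maximalIdeal A * I ^ (2 * s))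
    (hf : ∀ s, f ^ (s + 1) ∉ IsLocalRing.maximalIdeal A * I ^ (s + 1) + T * I ^ s) :
    ringKrullDim A ≤ Y.card + 1 := by
  classical
  set m := IsLocalRing.maximalIdeal A
  have hf0 : f ≠ 0 := by
    rintro rfl
    exact hf 0 (by simp)
  let K := FractionRing A
  let φ := algebraMap A K
  have hφ : Function.Injective φ := IsFractionRing.injective A K
  have hφf : φ f ≠ 0 := (map_ne_zero_iff φ hφ).mpr hf0
  let g : A → K := fun a ↦ φ a / φ f
  let s : Finset K := (Y ∪ Z).image g
  let B := Algebra.adjoin A (s : Set K)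
  let ι := algebraMap A B
  have hιinj : Function.Injective ι := FaithfulSMul.algebraMap_injective A B
  have hgB {a : A} (ha : a ∈ Y ∪ Z) : g a ∈ B :=
    Algebra.subset_adjoin (Finset.mem_coe.mpr (Finset.mem_image_of_mem g ha))
  have hg (a : A) (h : g a ∈ B) : (⟨g a, h⟩ : B) * ι f = ι a :=
    Subtype.ext (div_mul_cancel₀ _ hφf)
  have : Algebra.FiniteType A B :=
    (Subalgebra.fg_iff_finiteType _).mp (Subalgebra.fg_adjoin_finset s)
  have : IsNoetherianRing B := Algebra.FiniteType.isNoetherianRing A B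
  have hYT {a : A} (ha : a ∈ Y ∪ Z) : a ∈ T := by
    rw [hT]
    rcases Finset.mem_union.mp ha with ha | ha
    · exact Ideal.mem_sup_left (Ideal.subset_span ha)
    · exact Ideal.mem_sup_right (Ideal.subset_span ha)
  have hTI : T ≤ I := hI ▸ le_sup_right
  have hfI : f ∈ I := by
    rw [hI]
    exact Ideal.mem_sup_left (Ideal.mem_span_singleton_self f)
  have hImap : I.map ι ≤ Ideal.span {ι f} := by
    rw [hI, hT, Ideal.map_sup, Ideal.map_sup, Ideal.map_span, Ideal.map_span, Ideal.map_span,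
      Set.image_singleton]
    refine sup_le le_rfl (sup_le ?_ ?_)
    all_goals
      rw [Ideal.span_le]
      rintro _ ⟨a, ha, rfl⟩
      rw [← hg a (hgB (by simp [Finset.mem_coe.mp ha]))]
      exact Ideal.mul_mem_left _ _ (Ideal.mem_span_singleton_self _)
  have hdiv {J : Ideal A} {k : ℕ} {a : A} (ha : a ∈ J * I ^ k) :
      ∃ b ∈ J.map ι, b * ι f ^ k = ι a := by
    have := Ideal.mem_map_of_mem ι ha
    rw [Ideal.map_mul, Ideal.map_pow] at this
    have := Ideal.mul_mono_right (Ideal.pow_right_mono hImap k) this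
    rwa [Ideal.span_singleton_pow, Ideal.mem_mul_span_singleton] at this
  have hfrac (b : B) : ∃ k, ∃ a ∈ I ^ k, b * ι f ^ k = ι a := by
    obtain ⟨b, hb⟩ := b
    induction hb using Algebra.adjoin_induction with
    | mem x hx =>
      obtain ⟨a, ha, rfl⟩ := Finset.mem_image.mp hx
      exact ⟨1, a, by simpa using hTI (hYT ha), by rw [pow_one]; exact hg a _⟩
    | algebraMap r => exact ⟨0, r, by simp, by rw [pow_zero, mul_one]; rfl⟩
    | add x y hx hy ihx ihy =>
      obtain ⟨k, a, ha, hxa⟩ := ihx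
      obtain ⟨l, c, hc, hyc⟩ := ihy
      refine ⟨k + l, a * f ^ l + c * f ^ k, ?_, ?_⟩
      · refine add_mem ?_ ?_
        · rw [pow_add]
          exact Ideal.mul_mem_mul ha (Ideal.pow_mem_pow hfI l)
        · rw [pow_add, mul_comm c]
          exact Ideal.mul_mem_mul (Ideal.pow_mem_pow hfI k) hc
      · rw [map_add, map_mul, map_mul, map_pow, map_pow, ← hxa, ← hyc]
        change (⟨x, hx⟩ + ⟨y, hy⟩ : B) * _ = _
        ring
    | mul x y hx hy ihx ihy =>
      obtain ⟨k, a, ha, hxa⟩ := ihx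
      obtain ⟨l, c, hc, hyc⟩ := ihy
      refine ⟨k + l, a * c, ?_, ?_⟩
      · rw [pow_add]
        exact Ideal.mul_mem_mul ha hc
      · rw [map_mul, ← hxa, ← hyc]
        change (⟨x, hx⟩ * ⟨y, hy⟩ : B) * _ = _
        ring
  let W : ℕ → Ideal A := fun k ↦ m * I ^ (k + 1) + T * I ^ k
  have hW {k l : ℕ} {a c : A} (ha : a ∈ W k) (hc : c ∈ I ^ l) : a * c ∈ W (k + l) := by
    have h : W k * I ^ l = W (k + l) := by
      simp only [W, add_mul, mul_assoc, ← pow_add]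
      congr 3
      omega
    exact h ▸ Ideal.mul_mem_mul ha hc
  let G : Set B := {y | (y : K) ∈ s}
  let n : Ideal B := Ideal.span (ι '' m ∪ G)
  have hn {b : B} (hb : b ∈ n) : ∃ k, ∃ a ∈ W k, b * ι f ^ (k + 1) = ι a := by
    induction hb using Submodule.span_induction with
    | mem x hx =>
      rcases hx with ⟨a, ha, rfl⟩ | hx
      · refine ⟨0, a * f, Ideal.mem_sup_left ?_, by simp⟩
        simpa using Ideal.mul_mem_mul ha hfI
      · obtain ⟨a, ha, hax⟩ := Finset.mem_image.mp hx
        refine ⟨0, a, Ideal.mem_sup_right ?_, ?_⟩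
        · simpa using hYT ha
        · rw [zero_add, pow_one, ← hg a (hgB ha)]
          congr 1
          exact Subtype.ext hax.symm
    | zero => exact ⟨0, 0, zero_mem _, by simp⟩
    | add x y hx hy ihx ihy =>
      obtain ⟨k, a, ha, hxa⟩ := ihx
      obtain ⟨l, c, hc, hyc⟩ := ihy
      refine ⟨k + (l + 1), a * f ^ (l + 1) + c * f ^ (k + 1), add_mem
        (hW ha (Ideal.pow_mem_pow hfI _)) ?_, ?_⟩
      · have := hW hc (Ideal.pow_mem_pow hfI (k + 1))
        rwa [show l + (k + 1) = k + (l + 1) by omega] at this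
      · rw [map_add, map_mul, map_mul, map_pow, map_pow, ← hxa, ← hyc]
        ring
    | smul b x hx ihx =>
      obtain ⟨k, a, ha, hxa⟩ := ihx
      obtain ⟨l, c, hc, hbc⟩ := hfrac b
      refine ⟨k + l, a * c, hW ha hc, ?_⟩
      rw [map_mul, ← hxa, ← hbc, smul_eq_mul]
      ring
  have hntop : n ≠ ⊤ := by
    intro h
    obtain ⟨k, a, ha, h1⟩ := hn (b := 1) (h ▸ Submodule.mem_top)
    rw [one_mul, ← map_pow] at h1
    exact hf k (hιinj h1 ▸ ha)
  obtain ⟨N, hNmax, hnN⟩ := Ideal.exists_le_maximal n hntop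
  have hmn {a : A} (ha : a ∈ m) : ι a ∈ n := Ideal.subset_span (Or.inl ⟨a, ha, rfl⟩)
  have hGn {y : B} (hy : (y : K) ∈ s) : y ∈ n := Ideal.subset_span (Or.inr hy)
  have hcomap : N.comap ι = m :=
    ((IsLocalRing.maximalIdeal.isMaximal A).eq_of_le (Ideal.comap_ne_top ι hNmax.ne_top)
      fun a ha ↦ hnN (hmn ha)).symm
  have hres (b : B) : ∃ a, b - ι a ∈ n := by
    obtain ⟨b, hb⟩ := b
    induction hb using Algebra.adjoin_induction with
    | mem x hx => exact ⟨0, by simpa using hGn hx⟩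
    | algebraMap r => exact ⟨r, by convert n.zero_mem; exact sub_eq_zero.mpr rfl⟩
    | add x y hx hy ihx ihy =>
      obtain ⟨a, ha⟩ := ihx
      obtain ⟨c, hc⟩ := ihy
      refine ⟨a + c, ?_⟩
      convert add_mem ha hc using 1
      rw [map_add, show (⟨x + y, add_mem hx hy⟩ : B) = ⟨x, hx⟩ + ⟨y, hy⟩ from rfl]
      ring
    | mul x y hx hy ihx ihy =>
      obtain ⟨a, ha⟩ := ihx
      obtain ⟨c, hc⟩ := ihy
      refine ⟨a * c, ?_⟩
      convert add_mem (n.mul_mem_right (⟨y, hy⟩ : B) ha) (n.mul_mem_left (ι a) hc) using 1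
      rw [map_mul, show (⟨x * y, mul_mem hx hy⟩ : B) = ⟨x, hx⟩ * ⟨y, hy⟩ from rfl]
      ring
  have hNn : N ≤ n := by
    intro x hx
    obtain ⟨a, ha⟩ := hres x
    have haN : ι a ∈ N := by simpa using N.sub_mem hx (hnN ha)
    have : a ∈ m := hcomap ▸ haN
    simpa using n.add_mem ha (hmn this)
  let Y' : Finset B := insert (ι f) (Y.attach.image fun y : {y // y ∈ Y} ↦
    (⟨g y.1, hgB (Finset.mem_union_left _ y.2)⟩ : B))
  have hY'N : Ideal.span (Y' : Set B) ≤ N := by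
    rw [Ideal.span_le, Finset.coe_insert, Set.insert_subset_iff]
    refine ⟨hnN (hmn hfm), fun x hx ↦ ?_⟩
    obtain ⟨y, -, rfl⟩ := Finset.mem_image.mp hx
    exact hnN (hGn (Finset.mem_image_of_mem g (Finset.mem_union_left _ y.2)))
  have hmin : N ∈ (Ideal.span (Y' : Set B)).minimalPrimes := by
    refine ⟨⟨hNmax.isPrime, hY'N⟩, fun Q ⟨hQ, hYQ⟩ _ ↦ hNn.trans ?_⟩
    have hfQ : ι f ∈ Q := hYQ (Ideal.subset_span (by simp [Y']))
    have hmQ : m.map ι ≤ Q := by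
      rw [Ideal.map_le_iff_le_comap]
      have hIQ : I ≤ Q.comap ι := by
        rw [← Ideal.map_le_iff_le_comap]
        exact hImap.trans (by simpa [Ideal.span_le] using hfQ)
      exact hmI.trans ((Ideal.radical_mono hIQ).trans (Ideal.IsPrime.radical inferInstance).le)
    refine Ideal.span_le.mpr (Set.union_subset ?_ fun x hx ↦ ?_)
    · rintro _ ⟨a, ha, rfl⟩
      exact hmQ (Ideal.mem_map_of_mem ι ha)
    · obtain ⟨a, ha, hax⟩ := Finset.mem_image.mp hx
      have hxa : x * ι f = ι a := by
        rw [← hg a (hgB ha)]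
        congr 1
        exact Subtype.ext hax.symm
      rcases Finset.mem_union.mp ha with ha | ha
      · refine hYQ (Ideal.subset_span ?_)
        refine Finset.mem_insert_of_mem (Finset.mem_image.mpr ⟨⟨a, ha⟩, by simp, ?_⟩)
        exact Subtype.ext hax
      · obtain ⟨k, hk⟩ := hZ a ha
        obtain ⟨b, hb, hbk⟩ := hdiv hk
        have : x ^ k = b := by
          have hne : ι f ^ (2 * k) ≠ 0 :=
            pow_ne_zero _ ((map_ne_zero_iff ι hιinj).mpr hf0)
          refine mul_right_cancel₀ hne ?_
          rw [hbk, map_mul, map_pow, map_pow, ← hxa]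
          ring
        exact hQ.mem_of_pow_mem k (this ▸ hmQ hb)
  have h1 := Ideal.height_le_card_of_mem_minimalPrimes_span_finset hmin
  have h2 := huc.height_comap_le_of_eq_adjoin s B rfl N fun y hy ↦ hnN (hGn hy)
  rw [← IsLocalRing.maximalIdeal_height_eq_ringKrullDim]
  have h3 : Y'.card ≤ Y.card + 1 := by
    refine (Finset.card_insert_le _ _).trans (Nat.add_le_add_right ?_ 1)
    exact Finset.card_image_le.trans (Finset.card_attach).le
  have h4 : m.height ≤ (Y.card + 1 : ℕ) := by
    rw [← hcomap]
    exact h2.trans (h1.trans (by exact_mod_cast h3))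
  exact_mod_cast h4

theorem Ideal.pow_sub_pow_mem_mul_pow {S : Type*} [CommRing S] {m J : Ideal S} {u v : S}
    (hu : u ∈ J) (hv : v ∈ J) (h : u - v ∈ m * J) (s : ℕ) : u ^ s - v ^ s ∈ m * J ^ s := by
  induction s with
  | zero => simp
  | succ s ih =>
    have e : u ^ (s + 1) - v ^ (s + 1) = (u ^ s - v ^ s) * u + (u - v) * v ^ s := by ring
    rw [e]
    refine add_mem ?_ ?_
    · rw [pow_succ, ← mul_assoc]
      exact Ideal.mul_mem_mul ih hu
    · rw [pow_succ', ← mul_assoc]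
      exact Ideal.mul_mem_mul h (Ideal.pow_mem_pow hv s)

theorem Ideal.le_radical_of_pow_mem_sup {D : Type*} [CommRing D] [IsLocalRing D]
    [IsNoetherianRing D] {J V : Ideal D} {F : D} {s : ℕ}
    (hJ : IsLocalRing.maximalIdeal D ≤ J.radical) (hFJ : F ∈ J)
    (hle : J ≤ Ideal.span {F} ⊔ (V ⊔ IsLocalRing.maximalIdeal D * J))
    (hF : F ^ (s + 1) ∈ V ⊔ IsLocalRing.maximalIdeal D * J ^ (s + 1)) :
    IsLocalRing.maximalIdeal D ≤ V.radical := by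
  set m := IsLocalRing.maximalIdeal D
  have key (k : ℕ) : J ^ (k + 1) ≤ Ideal.span {F ^ (k + 1)} ⊔ (V ⊔ m * J ^ (k + 1)) := by
    induction k with
    | zero => simpa using hle
    | succ k ih =>
      calc J ^ (k + 1 + 1) = J * J ^ (k + 1) := pow_succ' _ _
        _ ≤ J * (Ideal.span {F ^ (k + 1)} ⊔ (V ⊔ m * J ^ (k + 1))) := Ideal.mul_mono_right ih
        _ = J * Ideal.span {F ^ (k + 1)} ⊔ (J * V ⊔ J * (m * J ^ (k + 1))) := by
          rw [Ideal.mul_sup, Ideal.mul_sup]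
        _ ≤ _ := by
          refine sup_le ?_ (sup_le ?_ ?_)
          · refine (Ideal.mul_mono_left hle).trans ?_
            rw [Ideal.sup_mul, Ideal.sup_mul, Ideal.span_singleton_mul_span_singleton, ← pow_succ']
            refine sup_le_sup_left (sup_le_sup Ideal.mul_le_left ?_) _
            rw [pow_succ' J, ← mul_assoc]
            refine Ideal.mul_mono_right ?_
            rw [Ideal.span_singleton_le_iff_mem]
            exact Ideal.pow_mem_pow hFJ _
          · exact le_sup_of_le_right (le_sup_of_le_left Ideal.mul_le_right)
          · refine le_sup_of_le_right (le_sup_of_le_right ?_)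
            rw [pow_succ' J (k + 1), mul_left_comm]
  have h1 : J ^ (s + 1) ≤ V ⊔ m • J ^ (s + 1) :=
    (key s).trans (sup_le ((Ideal.span_singleton_le_iff_mem _).mpr hF) le_rfl)
  have h2 : J ^ (s + 1) ≤ V := Submodule.le_of_le_smul_of_le_jacobson_bot
    (IsNoetherian.noetherian _) (IsLocalRing.maximalIdeal_le_jacobson _) h1
  rw [← Ideal.radical_pow J (Nat.succ_ne_zero s)] at hJ
  exact hJ.trans (Ideal.radical_mono h2)

theorem Ideal.exists_mem_notMem_forall_isNilpotent_mul {S : Type*} [CommRing S]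
    [IsNoetherianRing S] {q m : Ideal S} (hq : q ∈ minimalPrimes S) (hm : ¬ m ≤ q) :
    ∃ a ∈ m, a ∉ q ∧ ∀ z ∈ q, IsNilpotent (a * z) := by
  classical
  have hqp : q.IsPrime := hq.1.1
  have hfin : (minimalPrimes S).Finite := minimalPrimes.finite_of_isNoetherianRing S
  let s := hfin.toFinset.erase q
  have hL : ¬ m * ∏ p ∈ s, p ≤ q := by
    rw [hqp.mul_le, not_or]
    refine ⟨hm, fun h ↦ ?_⟩
    obtain ⟨p, hp, hpq⟩ := (hqp.prod_le).mp h
    have hp' := Finset.mem_erase.mp hp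
    have hpm : p ∈ minimalPrimes S := by simpa using hp'.2
    exact hp'.1 (le_antisymm hpq (hq.2 hpm.1 hpq))
  obtain ⟨a, ha, haq⟩ := SetLike.not_le_iff_exists.mp hL
  refine ⟨a, Ideal.mul_le_left ha, haq, fun z hz ↦ ?_⟩
  rw [← mem_nilradical, nilradical, ← Ideal.sInf_minimalPrimes, Ideal.mem_sInf]
  intro p hp
  by_cases hpq : p = q
  · exact hpq ▸ q.mul_mem_left a hz
  · have hps : p ∈ s := Finset.mem_erase.mpr ⟨hpq, by simpa using! hp⟩
    exact p.mul_mem_right z ((Ideal.prod_le_inf.trans (Finset.inf_le hps)) (Ideal.mul_le_right ha))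

theorem IsLocalRing.exists_finset_card_add_one_le_ringKrullDim {D : Type*} [CommRing D]
    [IsDomain D] [IsLocalRing D] [IsNoetherianRing D] {a : D}
    (ha : a ∈ IsLocalRing.maximalIdeal D) (ha0 : a ≠ 0) :
    ∃ X : Finset D, (X : Set D) ⊆ IsLocalRing.maximalIdeal D ∧
      ((X.card + 1 : ℕ) : WithBot ℕ∞) ≤ ringKrullDim D ∧
      IsLocalRing.maximalIdeal D ≤ (Ideal.span {a} ⊔ Ideal.span X).radical := by
  classical
  let E := D ⧸ Ideal.span {a}
  let π : D →+* E := Ideal.Quotient.mk _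
  have hπ : Function.Surjective π := Ideal.Quotient.mk_surjective
  have : Nontrivial E := Ideal.Quotient.nontrivial_iff.mpr fun h ↦
    (Ideal.IsPrime.ne_top inferInstance)
      (top_le_iff.mp (h ▸ (Ideal.span_singleton_le_iff_mem _).mpr ha))
  have : IsLocalRing E := IsLocalRing.of_surjective' π hπ
  have hcm : (IsLocalRing.maximalIdeal E).comap π = IsLocalRing.maximalIdeal D :=
    IsLocalRing.eq_maximalIdeal (Ideal.comap_isMaximal_of_surjective π hπ)
  obtain ⟨s, hs, hcard⟩ :=
    Ideal.exists_finset_card_eq_height_of_isNoetherianRing (IsLocalRing.maximalIdeal E)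
  have hsm : Ideal.span (s : Set E) ≤ IsLocalRing.maximalIdeal E := hs.1.2
  have hrad : IsLocalRing.maximalIdeal E ≤ (Ideal.span (s : Set E)).radical := by
    rw [Ideal.radical_eq_sInf]
    refine le_sInf fun p hp ↦ ?_
    exact hs.2 ⟨hp.2, hp.1⟩ (IsLocalRing.le_maximalIdeal hp.2.ne_top)
  let X := s.image (Function.surjInv hπ)
  have hX : (Ideal.span (X : Set D)).map π = Ideal.span s := by
    rw [Ideal.map_span, Finset.coe_image, ← Set.image_comp, Function.comp_surjInv, Set.image_id]
  refine ⟨X, ?_, ?_, ?_⟩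
  · intro x hx
    rw [← hcm]
    refine hsm ?_
    rw [← hX]
    exact Ideal.mem_map_of_mem π (Ideal.subset_span hx)
  · have h1 := ringKrullDim_quotient_succ_le_of_nonZeroDivisor (mem_nonZeroDivisors_of_ne_zero ha0)
    refine le_trans ?_ h1
    rw [← IsLocalRing.maximalIdeal_height_eq_ringKrullDim, ← hcard]
    have : X.card ≤ s.card := Finset.card_image_le
    exact_mod_cast Nat.add_le_add_right this 1
  · have : Ideal.span {a} ⊔ Ideal.span X = (Ideal.span (s : Set E)).comap π := by
      rw [← hX, Ideal.comap_map_of_surjective' π hπ, Ideal.mk_ker, sup_comm]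
    rw [this, ← Ideal.comap_radical, ← hcm]
    exact Ideal.comap_mono hrad

/-- A homomorphism of local rings `A → S` with `𝔪_S = 𝔪_A S`, inducing surjections
`A → S / 𝔪_S ^ k` with kernel contained in `𝔪_A ^ k`. -/
structure RingHom.IsAdicallyDense {A S : Type*} [CommRing A] [IsLocalRing A] [CommRing S]
    [IsLocalRing S] (φ : A →+* S) : Prop where
  map_maximalIdeal : (IsLocalRing.maximalIdeal A).map φ = IsLocalRing.maximalIdeal S
  exists_sub_mem : ∀ k s, ∃ a, s - φ a ∈ IsLocalRing.maximalIdeal S ^ k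
  comap_pow_le : ∀ k, (IsLocalRing.maximalIdeal S ^ k).comap φ ≤ IsLocalRing.maximalIdeal A ^ k

namespace RingHom.IsAdicallyDense

variable {A S : Type*} [CommRing A] [IsLocalRing A] [CommRing S] [IsLocalRing S] {φ : A →+* S}

theorem exists_mem_sub_mem (h : φ.IsAdicallyDense) (J : Ideal A) (k : ℕ) {s : S}
    (hs : s ∈ J.map φ) : ∃ j ∈ J, s - φ j ∈ IsLocalRing.maximalIdeal S ^ k := by
  induction hs using Submodule.span_induction with
  | mem x hx =>
    obtain ⟨a, ha, rfl⟩ := hx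
    exact ⟨a, ha, by simp⟩
  | zero => exact ⟨0, zero_mem _, by simp⟩
  | add x y _ _ hx hy =>
    obtain ⟨a, ha, hxa⟩ := hx
    obtain ⟨b, hb, hyb⟩ := hy
    refine ⟨a + b, add_mem ha hb, ?_⟩
    rw [map_add, add_sub_add_comm]
    exact add_mem hxa hyb
  | smul r x _ hx =>
    obtain ⟨a, ha, hxa⟩ := hx
    obtain ⟨c, hc⟩ := h.exists_sub_mem k r
    refine ⟨c * a, J.mul_mem_left c ha, ?_⟩
    have : r • x - φ (c * a) = r * (x - φ a) + φ a * (r - φ c) := by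
      rw [map_mul, smul_eq_mul]
      ring
    rw [this]
    exact add_mem (Ideal.mul_mem_left _ _ hxa) (Ideal.mul_mem_left _ _ hc)

theorem comap_map_le (h : φ.IsAdicallyDense) {J : Ideal A} {k : ℕ}
    (hJ : IsLocalRing.maximalIdeal A ^ k ≤ J) : (J.map φ).comap φ ≤ J := by
  intro x hx
  obtain ⟨j, hj, hxj⟩ := h.exists_mem_sub_mem J k hx
  rw [← map_sub] at hxj
  simpa using J.add_mem (hJ (h.comap_pow_le k hxj)) hj

theorem pow_le_of_pow_le_map [IsNoetherianRing A] (h : φ.IsAdicallyDense) {J : Ideal A} {k : ℕ}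
    (hJ : IsLocalRing.maximalIdeal S ^ k ≤ J.map φ) : IsLocalRing.maximalIdeal A ^ k ≤ J := by
  refine Submodule.le_of_le_smul_of_le_jacobson_bot (I := IsLocalRing.maximalIdeal A)
    (IsNoetherian.noetherian _) (IsLocalRing.maximalIdeal_le_jacobson _) fun x hx ↦ ?_
  have hx' : φ x ∈ J.map φ := by
    refine hJ ?_
    rw [← h.map_maximalIdeal, ← Ideal.map_pow]
    exact Ideal.mem_map_of_mem φ hx
  obtain ⟨j, hj, hxj⟩ := h.exists_mem_sub_mem J (k + 1) hx'
  rw [← map_sub] at hxj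
  have := h.comap_pow_le (k + 1) (Ideal.mem_comap.mpr hxj)
  rw [pow_succ'] at this
  exact Submodule.mem_sup.mpr ⟨j, hj, _, this, by ring⟩

theorem mem_maximalIdeal_iff (h : φ.IsAdicallyDense) {a : A} :
    φ a ∈ IsLocalRing.maximalIdeal S ↔ a ∈ IsLocalRing.maximalIdeal A := by
  constructor
  · intro ha
    simpa using h.comap_pow_le 1 (x := a) (by simpa using ha)
  · intro ha
    exact h.map_maximalIdeal ▸ Ideal.mem_map_of_mem φ ha

end RingHom.IsAdicallyDense

/-- Let `A → S` be an adically dense homomorphism of Noetherian local rings, such as a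
completion. If `A` is a universally catenary domain, then `dim A ≤ dim S / q` for every minimal
prime `q` of `S`. -/
theorem Paper.IsUnivCatenary.ringKrullDim_le_ringKrullDim_quotient {A : Type} {S : Type*}
    [CommRing A] [IsDomain A] [IsNoetherianRing A] [IsLocalRing A]
    (huc : Paper.IsUnivCatenary A) [CommRing S] [IsNoetherianRing S] [IsLocalRing S]
    {φ : A →+* S} (hφ : φ.IsAdicallyDense) {q : Ideal S} (hq : q ∈ minimalPrimes S) :
    ringKrullDim A ≤ ringKrullDim (S ⧸ q) := by
  classical
  have hqp : q.IsPrime := hq.1.1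
  set mA := IsLocalRing.maximalIdeal A
  set mS := IsLocalRing.maximalIdeal S
  by_cases hmq : mS ≤ q
  · have hnil : mS ≤ (⊥ : Ideal S).radical := by
      rw [← Ideal.sInf_minimalPrimes]
      refine le_sInf fun p hp ↦ ?_
      refine hmq.trans (hq.2 hp.1 ?_)
      exact (IsLocalRing.le_maximalIdeal hp.1.1.ne_top).trans hmq
    obtain ⟨k, hk⟩ := Ideal.exists_pow_le_of_le_radical_of_fg hnil (IsNoetherian.noetherian _)
    have h1 : mA ^ k ≤ ⊥ := hφ.pow_le_of_pow_le_map (hk.trans bot_le)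
    have h2 : mA = ⊥ := by
      by_contra hne
      exact pow_ne_zero k hne (le_bot_iff.mp h1)
    rw [ringKrullDim_eq_zero_of_isField (IsLocalRing.isField_iff_maximalIdeal_eq.mpr h2)]
    exact ringKrullDim_nonneg_of_nontrivial
  obtain ⟨a, ham, haq, haz⟩ := Ideal.exists_mem_notMem_forall_isNilpotent_mul hq hmq
  let D := S ⧸ q
  let π : S →+* D := Ideal.Quotient.mk q
  have hπ : Function.Surjective π := Ideal.Quotient.mk_surjective
  have : IsLocalRing D := IsLocalRing.of_surjective' π hπ
  let mD := IsLocalRing.maximalIdeal D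
  have hcm : mD.comap π = mS :=
    IsLocalRing.eq_maximalIdeal (Ideal.comap_isMaximal_of_surjective π hπ)
  have hmSD : mS.map π = mD := by rw [← hcm, Ideal.map_comap_of_surjective π hπ]
  obtain ⟨X, hXm, hXcard, hXrad⟩ := IsLocalRing.exists_finset_card_add_one_le_ringKrullDim
    (a := π a) (hcm.symm ▸ ham : a ∈ mD.comap π) (by rwa [Ne, Ideal.Quotient.eq_zero_iff_mem])
  obtain ⟨Z', hZ'⟩ := (IsNoetherian.noetherian q : q.FG)
  let X' := X.image (Function.surjInv hπ)
  have hX' : (Ideal.span (X' : Set S)).map π = Ideal.span X := by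
    rw [Ideal.map_span, Finset.coe_image, ← Set.image_comp, Function.comp_surjInv, Set.image_id]
  let J := Ideal.span {a} ⊔ (Ideal.span (X' : Set S) ⊔ Ideal.span (Z' : Set S))
  have hJD : J.map π = Ideal.span {π a} ⊔ Ideal.span X := by
    have : (Ideal.span (Z' : Set S)).map π = ⊥ := by
      change Ideal.map π (Submodule.span S (Z' : Set S)) = ⊥
      rw [hZ', Ideal.map_quotient_self]
    rw [Ideal.map_sup, Ideal.map_sup, hX', this, Ideal.map_span, Set.image_singleton, sup_bot_eq]
  have hqJ : q ≤ J := by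
    rw [← hZ']
    exact le_sup_of_le_right le_sup_right
  have hJcomap : (J.map π).comap π = J := by
    rw [Ideal.comap_map_of_surjective' π hπ, Ideal.mk_ker, sup_eq_left.mpr hqJ]
  have hJrad : mS ≤ J.radical := by
    rw [← hcm, ← hJcomap, ← Ideal.comap_radical, hJD]
    exact Ideal.comap_mono hXrad
  have haJ : a ∈ J := Ideal.mem_sup_left (Ideal.mem_span_singleton_self a)
  have hXJ {x : S} (hx : x ∈ X') : x ∈ J :=
    Ideal.mem_sup_right (Ideal.mem_sup_left (Ideal.subset_span hx))
  have hZJ {x : S} (hx : x ∈ Z') : x ∈ J :=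
    Ideal.mem_sup_right (Ideal.mem_sup_right (Ideal.subset_span hx))
  have hJm : J ≤ mS := by
    refine sup_le ((Ideal.span_singleton_le_iff_mem _).mpr ham) (sup_le ?_ ?_)
    · rw [← hcm, ← Ideal.map_le_iff_le_comap, hX']
      exact Ideal.span_le.mpr hXm
    · exact hZ'.le.trans (IsLocalRing.le_maximalIdeal hqp.ne_top)
  obtain ⟨k, hk⟩ := Ideal.exists_pow_le_of_le_radical_of_fg hJrad (IsNoetherian.noetherian _)
  choose ρ hρ using hφ.exists_sub_mem (k + 1)
  have hρJ (x : S) : x - φ (ρ x) ∈ mS * J := by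
    refine Ideal.mul_mono_right hk ?_
    rw [← pow_succ']
    exact hρ x
  have hρmem {x : S} (hx : x ∈ J) : φ (ρ x) ∈ J := by
    simpa using J.sub_mem hx (Ideal.mul_le_right (hρJ x))
  let Y := X'.image ρ
  let Z := Z'.image ρ
  let T : Ideal A := Ideal.span Y ⊔ Ideal.span Z
  let I : Ideal A := Ideal.span {ρ a} ⊔ T
  have hIJ : I.map φ = J := by
    refine le_antisymm ?_ ?_
    · rw [Ideal.map_le_iff_le_comap]
      refine sup_le ?_ (sup_le ?_ ?_)
      · rw [Ideal.span_singleton_le_iff_mem]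
        exact hρmem haJ
      · rw [Ideal.span_le]
        intro y hy
        obtain ⟨x, hx, rfl⟩ := Finset.mem_image.mp hy
        exact hρmem (hXJ hx)
      · rw [Ideal.span_le]
        intro y hy
        obtain ⟨x, hx, rfl⟩ := Finset.mem_image.mp hy
        exact hρmem (hZJ hx)
    · have key {x : S} (hx : ρ x ∈ I) : x ∈ I.map φ ⊔ mS • J :=
        Submodule.mem_sup.mpr ⟨_, Ideal.mem_map_of_mem φ hx, _, hρJ x, by ring⟩
      refine Submodule.le_of_le_smul_of_le_jacobson_bot (I := mS) (IsNoetherian.noetherian _)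
        (IsLocalRing.maximalIdeal_le_jacobson _) (sup_le ?_ (sup_le ?_ ?_))
      · rw [Ideal.span_singleton_le_iff_mem]
        exact key (Ideal.mem_sup_left (Ideal.mem_span_singleton_self _))
      · rw [Ideal.span_le]
        exact fun x hx ↦ key (Ideal.mem_sup_right (Ideal.mem_sup_left
          (Ideal.subset_span (Finset.mem_coe.mpr (Finset.mem_image_of_mem ρ hx)))))
      · rw [Ideal.span_le]
        exact fun x hx ↦ key (Ideal.mem_sup_right (Ideal.mem_sup_right
          (Ideal.subset_span (Finset.mem_coe.mpr (Finset.mem_image_of_mem ρ hx)))))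
  have hkI : mA ^ k ≤ I := hφ.pow_le_of_pow_le_map (hIJ.symm ▸ hk)
  have hmI : mA ≤ I.radical := fun x hx ↦ ⟨k, hkI (Ideal.pow_mem_pow hx k)⟩
  have hcard : Y.card ≤ X.card := Finset.card_image_le.trans Finset.card_image_le
  refine le_trans (huc.ringKrullDim_le_card_add_one (ρ a) Y Z I T rfl rfl
    (hφ.mem_maximalIdeal_iff.mp (hJm (hρmem haJ))) hmI ?_ ?_) (le_trans ?_ hXcard)
  · intro z hz
    obtain ⟨z, hz', rfl⟩ := Finset.mem_image.mp hz
    have hzq : z ∈ q := by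
      rw [← hZ']
      exact Ideal.subset_span hz'
    obtain ⟨s, hs⟩ := haz z hzq
    refine ⟨s, ?_⟩
    have hle : mA ^ (1 + k * (2 * s)) ≤ mA * I ^ (2 * s) := by
      rw [pow_add, pow_one, pow_mul]
      exact Ideal.mul_mono_right (Ideal.pow_right_mono hkI _)
    refine hφ.comap_map_le hle ?_
    rw [Ideal.mem_comap]
    rw [Ideal.map_mul, hφ.map_maximalIdeal, Ideal.map_pow, hIJ, pow_mul, ← mul_pow, map_pow,
      map_mul]
    have hd : φ (ρ a) * φ (ρ z) - a * z ∈ mS * J ^ 2 := by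
      have e : φ (ρ a) * φ (ρ z) - a * z =
          -((a - φ (ρ a)) * φ (ρ z) + (z - φ (ρ z)) * a) := by ring
      rw [e, pow_two, ← mul_assoc]
      exact neg_mem (add_mem (Ideal.mul_mem_mul (hρJ a) (hρmem (hZJ hz')))
        (Ideal.mul_mem_mul (hρJ z) haJ))
    have hJ2 {x y : S} (hx : x ∈ J) (hy : y ∈ J) : x * y ∈ J ^ 2 :=
      pow_two J ▸ Ideal.mul_mem_mul hx hy
    have := Ideal.pow_sub_pow_mem_mul_pow (hJ2 (hρmem haJ) (hρmem (hZJ hz')))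
      (hJ2 haJ (hZJ hz')) hd s
    rwa [hs, sub_zero] at this
  · intro s hs
    let ψ := π.comp φ
    let J' := J.map π
    let V := (Ideal.span (Y : Set A)).map ψ
    have hIψ : I.map ψ = J' := by rw [← Ideal.map_map, hIJ]
    have hZV : (Ideal.span (Z : Set A)).map ψ ≤ mD * J' := by
      rw [Ideal.map_span, Ideal.span_le]
      rintro _ ⟨z, hz, rfl⟩
      obtain ⟨z, hz', rfl⟩ := Finset.mem_image.mp hz
      have hzq : π z = 0 := by
        rw [Ideal.Quotient.eq_zero_iff_mem, ← hZ']
        exact Ideal.subset_span hz'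
      have := Ideal.mem_map_of_mem π (hρJ z)
      rw [Ideal.map_mul, hmSD, map_sub, hzq, zero_sub] at this
      exact neg_mem_iff.mp this
    have hTψ : T.map ψ ≤ V ⊔ mD * J' := by
      rw [Ideal.map_sup]
      exact sup_le_sup_left hZV _
    have hmAψ : mA.map ψ = mD := by rw [← Ideal.map_map, hφ.map_maximalIdeal, hmSD]
    have hJ' : mD ≤ J'.radical := by
      change mD ≤ (J.map π).radical
      rw [hJD]
      exact hXrad
    have hle : J' ≤ Ideal.span {ψ (ρ a)} ⊔ (V ⊔ mD * J') := by
      conv_lhs => rw [← hIψ, Ideal.map_sup, Ideal.map_span, Set.image_singleton]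
      exact sup_le_sup_left hTψ _
    have hmem : ψ (ρ a) ^ (s + 1) ∈ V ⊔ mD * J' ^ (s + 1) := by
      have := Ideal.mem_map_of_mem ψ hs
      rw [Submodule.add_eq_sup, Ideal.map_sup, Ideal.map_mul, Ideal.map_mul, Ideal.map_pow,
        Ideal.map_pow, hIψ, hmAψ, map_pow] at this
      refine (sup_le le_sup_right ?_ : mD * J' ^ (s + 1) ⊔ T.map ψ * J' ^ s ≤ _) this
      refine (Ideal.mul_mono_left hTψ).trans ?_
      rw [Ideal.sup_mul, mul_assoc, ← pow_succ']
      exact sup_le_sup_right Ideal.mul_le_left _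
    have hrad := Ideal.le_radical_of_pow_mem_sup (F := ψ (ρ a)) hJ'
      (Ideal.mem_map_of_mem π (hρmem haJ)) hle hmem
    have hVm : V ≤ mD := by
      rw [← hmAψ]
      refine Ideal.map_mono (Ideal.span_le.mpr fun y hy ↦ ?_)
      obtain ⟨x, hx, rfl⟩ := Finset.mem_image.mp hy
      exact hφ.mem_maximalIdeal_iff.mp (hJm (hρmem (hXJ hx)))
    have hV : V = Ideal.span ((Y.image ψ : Finset D) : Set D) := by
      rw [Finset.coe_image, ← Ideal.map_span]
    have hmin : mD ∈ (Ideal.span ((Y.image ψ : Finset D) : Set D)).minimalPrimes := by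
      rw [← hV]
      exact ⟨⟨inferInstance, hVm⟩, fun p hp _ ↦
        hrad.trans ((Ideal.radical_mono hp.2).trans hp.1.radical.le)⟩
    have hht := Ideal.height_le_card_of_mem_minimalPrimes_span_finset hmin
    rw [← IsLocalRing.maximalIdeal_height_eq_ringKrullDim] at hXcard
    have h1 : ((X.card + 1 : ℕ) : ℕ∞) ≤ (Y.image ψ).card :=
      le_trans (by exact_mod_cast hXcard) hht
    have h2 : (Y.image ψ).card ≤ Y.card := Finset.card_image_le
    have h3 : X.card + 1 ≤ (Y.image ψ).card := by exact_mod_cast h1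
    omega
  · exact_mod_cast Nat.add_le_add_right hcard 1

open TensorProduct in
theorem Module.annihilator_tensorProduct_le_of_map_annihilator_le {A S M : Type*} [CommRing A]
    [CommRing S] [Algebra A S] [AddCommGroup M] [Module A M] [Module.Finite A M] {Q : Ideal S}
    [Q.IsPrime] (hQ : (Module.annihilator A M).map (algebraMap A S) ≤ Q) :
    Module.annihilator S (S ⊗[A] M) ≤ Q := by
  let p : Ideal A := Q.comap (algebraMap A S)
  have hp : (⟨p, inferInstance⟩ : PrimeSpectrum A) ∈ Module.support A M := by
    rw [Module.support_eq_zeroLocus]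
    exact Ideal.map_le_iff_le_comap.mp hQ
  rw [Module.mem_support_iff_nontrivial_residueField_tensorProduct] at hp
  let k := p.ResidueField
  let K := Q.ResidueField
  let _ : Algebra k K := (Ideal.ResidueField.map p Q (algebraMap A S) rfl).toAlgebra
  have : IsScalarTower A k K := IsScalarTower.of_algebraMap_eq fun a ↦ by
    change _ = Ideal.ResidueField.map p Q (algebraMap A S) rfl (algebraMap A k a)
    rw [Ideal.ResidueField.map_algebraMap]
    rfl
  have hK : Nontrivial (K ⊗[A] M) := by
    have : Nontrivial (k ⊗[A] M) := hp
    have : Nontrivial (K ⊗[k] (k ⊗[A] M)) := inferInstance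
    exact (AlgebraTensorModule.cancelBaseChange A k K K M).symm.toEquiv.nontrivial
  have hK' : Nontrivial (K ⊗[S] (S ⊗[A] M)) :=
    (AlgebraTensorModule.cancelBaseChange A S K K M).toEquiv.nontrivial
  intro x hx
  by_contra hxQ
  have hx0 : algebraMap S K x ≠ 0 := by rwa [Ne, Ideal.algebraMap_residueField_eq_zero]
  have hz : ∀ t : K ⊗[S] (S ⊗[A] M), algebraMap S K x • t = 0 := by
    intro t
    rw [algebraMap_smul]
    induction t using TensorProduct.induction_on with
    | zero => simp
    | tmul c m => rw [← TensorProduct.tmul_smul, Module.mem_annihilator.mp hx, TensorProduct.tmul_zero]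
    | add a b ha hb => rw [smul_add, ha, hb, add_zero]
  obtain ⟨t, ht⟩ := exists_ne (0 : K ⊗[S] (S ⊗[A] M))
  exact ht ((smul_eq_zero_iff_right hx0).mp (hz t))

namespace RingHom.IsAdicallyDense

variable {A S : Type*} [CommRing A] [IsLocalRing A] [CommRing S] [IsLocalRing S] {φ : A →+* S}

theorem quotientMap (h : φ.IsAdicallyDense) (J : Ideal A) [IsLocalRing (A ⧸ J)]
    [IsLocalRing (S ⧸ J.map φ)] :
    (Ideal.quotientMap (J.map φ) φ Ideal.le_comap_map).IsAdicallyDense := by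
  have hA : (IsLocalRing.maximalIdeal A).map (Ideal.Quotient.mk J) =
    IsLocalRing.maximalIdeal (A ⧸ J) :=
    IsLocalRing.map_maximalIdeal_of_surjective _ Ideal.Quotient.mk_surjective
  have hS : (IsLocalRing.maximalIdeal S).map (Ideal.Quotient.mk (J.map φ)) =
    IsLocalRing.maximalIdeal (S ⧸ J.map φ) :=
    IsLocalRing.map_maximalIdeal_of_surjective _ Ideal.Quotient.mk_surjective
  refine ⟨?_, fun k s ↦ ?_, fun k x hx ↦ ?_⟩
  · rw [← hA, Ideal.map_map, Ideal.quotientMap_comp_mk, ← Ideal.map_map, h.map_maximalIdeal, hS]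
  · obtain ⟨s, rfl⟩ := Ideal.Quotient.mk_surjective s
    obtain ⟨a, ha⟩ := h.exists_sub_mem k s
    refine ⟨Ideal.Quotient.mk J a, ?_⟩
    rw [Ideal.quotientMap_mk, ← map_sub, ← hS, ← Ideal.map_pow]
    exact Ideal.mem_map_of_mem _ ha
  · obtain ⟨a, rfl⟩ := Ideal.Quotient.mk_surjective x
    rw [Ideal.mem_comap, Ideal.quotientMap_mk, ← hS, ← Ideal.map_pow, ← Ideal.mem_comap,
      Ideal.comap_map_of_surjective' _ Ideal.Quotient.mk_surjective, Ideal.mk_ker,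
      ← h.map_maximalIdeal, ← Ideal.map_pow, ← Ideal.map_sup] at hx
    have := h.comap_map_le (k := k) le_sup_left (Ideal.mem_comap.mpr hx)
    rw [← hA, ← Ideal.map_pow, ← Ideal.mem_comap,
      Ideal.comap_map_of_surjective' _ Ideal.Quotient.mk_surjective, Ideal.mk_ker]
    exact this

theorem ringKrullDim_le [IsNoetherianRing A] [IsNoetherianRing S] (h : φ.IsAdicallyDense) :
    ringKrullDim S ≤ ringKrullDim A := by
  classical
  obtain ⟨s, hs, hcard⟩ :=
    Ideal.exists_finset_card_eq_height_of_isNoetherianRing (IsLocalRing.maximalIdeal A)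
  have hmap : Ideal.span ((s.image φ : Finset S) : Set S) = (Ideal.span (s : Set A)).map φ := by
    rw [Finset.coe_image, Ideal.map_span]
  have hmin : IsLocalRing.maximalIdeal S ∈
      (Ideal.span ((s.image φ : Finset S) : Set S)).minimalPrimes := by
    rw [hmap]
    refine ⟨⟨inferInstance, ?_⟩, fun P ⟨hP, hle⟩ _ ↦ ?_⟩
    · rw [← h.map_maximalIdeal]
      exact Ideal.map_mono hs.1.2
    · rw [← h.map_maximalIdeal, Ideal.map_le_iff_le_comap]
      exact hs.2 ⟨inferInstance, Ideal.map_le_iff_le_comap.mp hle⟩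
        (IsLocalRing.le_maximalIdeal (Ideal.IsPrime.ne_top inferInstance))
  rw [← IsLocalRing.maximalIdeal_height_eq_ringKrullDim,
    ← IsLocalRing.maximalIdeal_height_eq_ringKrullDim, ← hcard]
  have h1 := Ideal.height_le_card_of_mem_minimalPrimes_span_finset hmin
  have h2 : (s.image φ).card ≤ s.card := Finset.card_image_le
  exact_mod_cast h1.trans (by exact_mod_cast h2)

end RingHom.IsAdicallyDense

theorem AdicCompletion.isAdicallyDense_algebraMap (R : Type*) [CommRing R] [IsNoetherianRing R]
    [IsLocalRing R] :
    (algebraMap R (AdicCompletion (IsLocalRing.maximalIdeal R) R)).IsAdicallyDense where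
  map_maximalIdeal := AdicCompletion.maximalIdeal_eq_map.symm
  exists_sub_mem k s := by
    rw [AdicCompletion.maximalIdeal_eq_map]
    exact AdicCompletion.exists_sub_algebraMap_mem (Ideal.fg_of_isNoetherianRing _) k s
  comap_pow_le k := by
    rw [AdicCompletion.maximalIdeal_eq_map]
    exact AdicCompletion.comap_map_pow_le (Ideal.fg_of_isNoetherianRing _) k

theorem Paper.coheight_eq_ringKrullDim_quotient (R : Type) [CommRing R] (I : Ideal R) :
    Paper.coheight R I = ringKrullDim (R ⧸ I) := by
  rw [ringKrullDim_quotient]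
  exact Order.krullDim_eq_of_orderIso
    { toFun := fun p ↦ ⟨⟨p.1, p.2.1⟩, p.2.2⟩
      invFun := fun p ↦ ⟨p.1.asIdeal, p.1.isPrime, p.2⟩
      left_inv := fun _ ↦ rfl
      right_inv := fun _ ↦ rfl
      map_rel_iff' := Iff.rfl }

theorem Paper.IsUnivCatenary.quotient {R : Type} [CommRing R] (huc : Paper.IsUnivCatenary R)
    (I : Ideal R) : Paper.IsUnivCatenary (R ⧸ I) := by
  intro B _ _ hB
  let _ : Algebra R B := Algebra.compHom B (Ideal.Quotient.mk I)
  have : IsScalarTower R (R ⧸ I) B := IsScalarTower.of_algebraMap_eq fun _ ↦ rfl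
  exact huc B (Algebra.FiniteType.trans (S := R ⧸ I) inferInstance hB)

theorem AdicCompletion.map_annihilator_le {R : Type*} [CommRing R] (I : Ideal R) (M : Type*)
    [AddCommGroup M] [Module R M] :
    (Module.annihilator R M).map (algebraMap R (AdicCompletion I R)) ≤
      Module.annihilator (AdicCompletion I R) (AdicCompletion I M) := by
  rw [Ideal.map_le_iff_le_comap]
  intro r hr
  rw [Ideal.mem_comap, Module.mem_annihilator]
  intro x
  rw [algebraMap_smul]
  ext n
  rw [AdicCompletion.val_smul_apply]
  obtain ⟨y, hy⟩ := Submodule.Quotient.mk_surjective _ (x.val n)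
  rw [← hy, ← Submodule.Quotient.mk_smul, Module.mem_annihilator.mp hr]
  simp

/-- Over a universally catenary Noetherian local ring, the completion of a finitely
generated equidimensional module is equidimensional. -/
theorem completion_equidim (R : Type) [CommRing R] [IsNoetherianRing R] [IsLocalRing R]
    (huc : Paper.IsUnivCatenary R)
    (M : Type) [AddCommGroup M] [Module R M] [Module.Finite R M]
    (hequi : Paper.IsEquidim R M) :
    Paper.IsEquidim (AdicCompletion (IsLocalRing.maximalIdeal R) R)
      (AdicCompletion (IsLocalRing.maximalIdeal R) M) := by
  intro Q hQ
  set S := AdicCompletion (IsLocalRing.maximalIdeal R) R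
  set N := AdicCompletion (IsLocalRing.maximalIdeal R) M
  have : IsNoetherianRing S := AdicCompletion.isNoetherianRing _
  let ι := algebraMap R S
  have hι : ι.IsAdicallyDense := AdicCompletion.isAdicallyDense_algebraMap R
  let a := Module.annihilator R M
  let b := Module.annihilator S N
  have hab : a.map ι ≤ b := AdicCompletion.map_annihilator_le _ M
  have hb {P : Ideal S} (hP : P.IsPrime) (haP : a.map ι ≤ P) : b ≤ P := by
    have e := AdicCompletion.ofTensorProductEquivOfFiniteNoetherian
      (IsLocalRing.maximalIdeal R) M
    change Module.annihilator S N ≤ P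
    rw [← e.annihilator_eq]
    exact Module.annihilator_tensorProduct_le_of_map_annihilator_le haP
  have hQp : Q.IsPrime := hQ.1.1
  obtain ⟨p, hp, hpQ⟩ := Ideal.exists_minimalPrimes_le
    (Ideal.map_le_iff_le_comap.mp (hab.trans hQ.1.2))
  have hpp : p.IsPrime := hp.1.1
  have hpQ' : p.map ι ≤ Q := Ideal.map_le_iff_le_comap.mpr hpQ
  have hQmin : Q ∈ (p.map ι).minimalPrimes :=
    ⟨⟨hQp, hpQ'⟩, fun P ⟨hP, hpP⟩ hPQ ↦ hQ.2 ⟨hP, hb hP ((Ideal.map_mono hp.1.2).trans hpP)⟩ hPQ⟩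
  have hlocal {B : Type} [CommRing B] [IsLocalRing B] {J P : Ideal B} (hP : P.IsPrime)
      (hJP : J ≤ P) : IsLocalRing (B ⧸ J) := by
    have : Nontrivial (B ⧸ J) := Ideal.Quotient.nontrivial_iff.mpr fun h ↦
      hP.ne_top (top_le_iff.mp (h ▸ hJP))
    exact IsLocalRing.of_surjective' _ Ideal.Quotient.mk_surjective
  have : IsLocalRing (R ⧸ p) := hlocal hpp le_rfl
  have : IsLocalRing (S ⧸ p.map ι) := hlocal hQp hpQ'
  have : IsLocalRing (R ⧸ a) := hlocal hpp hp.1.2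
  have : IsLocalRing (S ⧸ a.map ι) := hlocal hQp (hab.trans hQ.1.2)
  have hq : Q.map (Ideal.Quotient.mk (p.map ι)) ∈ minimalPrimes (S ⧸ p.map ι) := by
    have := Ideal.minimalPrimes_map_of_surjective
      (Ideal.Quotient.mk_surjective (I := p.map ι)) (p.map ι)
    rw [Ideal.map_quotient_self, Ideal.mk_ker, sup_idem] at this
    exact this.ge ⟨Q, hQmin, rfl⟩
  have h1 := (huc.quotient p).ringKrullDim_le_ringKrullDim_quotient (hι.quotientMap p) hq
  rw [ringKrullDim_eq_of_ringEquiv (DoubleQuot.quotQuotEquivQuotOfLE hpQ')] at h1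
  have h2 : ringKrullDim (R ⧸ p) = ringKrullDim (R ⧸ a) := by
    rw [← Paper.coheight_eq_ringKrullDim_quotient, ← Paper.coheight_eq_ringKrullDim_quotient]
    exact hequi p hp
  have h3 : ringKrullDim (S ⧸ a.map ι) ≤ ringKrullDim (R ⧸ a) := (hι.quotientMap a).ringKrullDim_le
  have h4 : ringKrullDim (S ⧸ b) ≤ ringKrullDim (S ⧸ a.map ι) :=
    ringKrullDim_le_of_surjective (Ideal.Quotient.factor hab) (Ideal.Quotient.factor_surjective hab)
  have h5 : ringKrullDim (S ⧸ Q) ≤ ringKrullDim (S ⧸ b) :=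
    ringKrullDim_le_of_surjective (Ideal.Quotient.factor hQ.1.2)
      (Ideal.Quotient.factor_surjective hQ.1.2)
  rw [Paper.dimMod, Paper.coheight_eq_ringKrullDim_quotient,
    Paper.coheight_eq_ringKrullDim_quotient]
  exact le_antisymm h5 (h4.trans (h3.trans (h2.ge.trans h1)))
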